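/- arXiv:2605.28311 — 3 statements merged into one kernel-verified Lean document; each statement's English description precedes it below -/
import Mathlib

section
/- Let X be a separable Banach space. Then X has the Point of Continuity Property if and only if Φ(X) < ω₁ (i.e., for every ε > 0 there exists a countable ordinal α with σ_ε^α(B_X) = ∅). -/
open Metric Set Topology

noncomputable section

/-- Transfinite iteration of a derivation `d` starting from `a`;
meets are taken at limit stages. -/
def derivIter {L : Type*} [CompleteLattice L] (d : L → L) (a : L) (α : Ordinal) : L :=
  Ordinal.limitRecOn α a (fun _ ih => d ih) (fun o _ ih => ⨅ (γ : Ordinal) (h : γ < o), ih γ h)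

/-- The weak topology of a real normed space. -/
def weakTop (X : Type*) [NormedAddCommGroup X] [NormedSpace ℝ X] : TopologicalSpace X :=
  TopologicalSpace.induced (fun (x : X) (f : X →L[ℝ] ℝ) => f x) inferInstance

variable {X : Type*} [NormedAddCommGroup X] [NormedSpace ℝ X]

/-- The dentability derivation `d_ε^1`. -/
def dentDeriv (ε : ℝ) (C : Set X) : Set X :=
  C \ ⋃ (f : X →L[ℝ] ℝ) (a : ℝ) (_ : Metric.diam ({y | a < f y} ∩ C) < ε), {y | a < f y}

/-- The weak fragmentation derivation `σ_ε^1`. -/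
def weakDeriv (ε : ℝ) (C : Set X) : Set X :=
  C \ ⋃ (V : Set X) (_ : IsOpen[weakTop X] V) (_ : Metric.diam (V ∩ C) < ε), V

/-- The convex weak fragmentation derivation `γ_ε^1`. -/
def convDeriv (ε : ℝ) (C : Set X) : Set X :=
  closure (convexHull ℝ (weakDeriv ε C))

/-- `treeRoot C δ α x` : `x` is the root of a `δ`-`α`-tree contained in `C`. -/
def treeRoot (C : Set X) (δ : ℝ) (α : Ordinal) : X → Prop :=
  Ordinal.limitRecOn α (fun x => x ∈ C)
    (fun _ ih x => x ∈ C ∧ ∃ y z : X,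
      x = (2⁻¹ : ℝ) • (y + z) ∧ δ ≤ 2⁻¹ * ‖y - z‖ ∧ ih y ∧ ih z)
    (fun o _ ih x => ∀ γ (h : γ < o), ih γ h x)

/-- `sprawlRoot C δ α x` : `x` is the root of a `δ`-`α`-sprawling tree contained in `C`. -/
def sprawlRoot (C : Set X) (δ : ℝ) (α : Ordinal) : X → Prop :=
  Ordinal.limitRecOn α (fun x => x ∈ C)
    (fun _ ih x => x ∈ C ∧ ∃ y z : ℕ → X,
      (∀ n, x = (2⁻¹ : ℝ) • (y n + z n)) ∧
      (∀ n m, n ≠ m → δ ≤ ‖y n - y m‖) ∧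
      (∀ n, ih (y n)) ∧ (∀ n, ih (z n)))
    (fun o _ ih x => ∀ γ (h : γ < o), ih γ h x)

/-- `bushRoot C δ α x` : `x` is the root of a `δ`-`α`-bush contained in `C`. -/
def bushRoot (C : Set X) (δ : ℝ) (α : Ordinal) : X → Prop :=
  Ordinal.limitRecOn α (fun x => x ∈ C)
    (fun _ ih x => x ∈ C ∧ ∃ (n : ℕ) (y : Fin (n + 1) → X) (lam : Fin (n + 1) → ℝ),
      (∀ i, 0 < lam i ∧ lam i ≤ 1) ∧ (∑ i, lam i = 1) ∧
      x = ∑ i, lam i • y i ∧ (∀ i, δ ≤ ‖x - y i‖) ∧ ∀ i, ih (y i))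
    (fun o _ ih x => ∀ γ (h : γ < o), ih γ h x)

/-- `X` has the Slice Point of Continuity Property. -/
def SlicePCP (X : Type*) [NormedAddCommGroup X] [NormedSpace ℝ X] : Prop :=
  ∀ A : Set X, A.Nonempty → Bornology.IsBounded A → ∀ ε > (0 : ℝ),
    ∃ (f : X →L[ℝ] ℝ) (a : ℝ), ({y | a < f y} ∩ A).Nonempty ∧
      ∀ x ∈ {y | a < f y} ∩ A, ∃ V ∈ @nhds X (weakTop X) x, Metric.diam (V ∩ A) < ε

section derivIter

variable {L : Type*} [CompleteLattice L] (d : L → L) (a : L)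

theorem derivIter_zero : derivIter d a 0 = a := by
  simp [derivIter]

theorem derivIter_add_one (α : Ordinal) : derivIter d a (α + 1) = d (derivIter d a α) := by
  simp [derivIter]

theorem derivIter_limit {α : Ordinal} (h : Order.IsSuccLimit α) :
    derivIter d a α = ⨅ (γ : Ordinal) (_ : γ < α), derivIter d a γ := by
  simp [derivIter, h]

theorem derivIter_antitone (hd : ∀ x, d x ≤ x) : Antitone (derivIter d a) := by
  intro α β
  induction β using Ordinal.limitRecOn with
  | zero =>
    intro h
    rw [nonpos_iff_eq_zero.1 h]
  | add_one β ih =>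
    intro h
    rcases h.lt_or_eq with h | rfl
    · rw [derivIter_add_one]
      exact (hd _).trans (ih (Order.lt_add_one_iff.1 h))
    · rfl
  | limit β hβ _ =>
    intro h
    rcases h.lt_or_eq with h | rfl
    · rw [derivIter_limit d a hβ]
      exact iInf₂_le α h
    · rfl

/-- A property closed under arbitrary infima and under `d` passes to all the iterates of `d`. -/
theorem derivIter_induction {p : L → Prop} (ha : p a) (hd : ∀ x ≤ a, p x → p (d x))
    (hle : ∀ x, d x ≤ x)
    (hinf : ∀ s : Set L, (∀ x ∈ s, p x) → p (sInf s))
    (α : Ordinal) : p (derivIter d a α) := by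
  induction α using Ordinal.limitRecOn with
  | zero => rwa [derivIter_zero]
  | add_one α ih =>
    rw [derivIter_add_one]
    refine hd _ ?_ ih
    simpa only [derivIter_zero] using derivIter_antitone d a hle (zero_le (a := α))
  | limit α hα ih =>
    have himage := sInf_image (s := Iio α) (f := derivIter d a)
    rw [derivIter_limit d a hα]
    simp only [mem_Iio] at himage
    rw [← himage]
    exact hinf _ (forall_mem_image.2 ih)

/-- In a second countable space, a decreasing transfinite iteration through closed sets
stabilises before the first uncountable ordinal. -/
theorem exists_derivIter_add_one_eq.{u, v} {Y : Type u} [TopologicalSpace Y]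
    [SecondCountableTopology Y]
    (d : Set Y → Set Y) (B : Set Y) (hd : ∀ C, d C ⊆ C)
    (hclosed : ∀ α : Ordinal.{v}, IsClosed (derivIter d B α)) :
    ∃ α : Ordinal.{v}, α < (Cardinal.aleph 1).ord ∧ derivIter d B (α + 1) = derivIter d B α := by
  by_contra! hne
  have hbasis := TopologicalSpace.isBasis_countableBasis Y
  have hsep : ∀ α : Set.Iio (Cardinal.aleph 1).ord, ∃ U : TopologicalSpace.countableBasis Y,
      (U.1 ∩ derivIter d B α).Nonempty ∧ Disjoint U.1 (derivIter d B (α + 1)) := by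
    rintro ⟨α, hα⟩
    have hss : derivIter d B (α + 1) ⊆ derivIter d B α :=
      derivIter_antitone d B hd le_self_add
    obtain ⟨x, hx, hx'⟩ := exists_of_ssubset (hss.ssubset_of_ne (hne α hα))
    obtain ⟨U, hU, hxU, hUsub⟩ :=
      hbasis.exists_subset_of_mem_open (u := (derivIter d B (α + 1))ᶜ) hx'
        (hclosed (α + 1)).isOpen_compl
    exact ⟨⟨U, hU⟩, ⟨x, hxU, hx⟩, disjoint_left.2 hUsub⟩
  choose U hmeet hdisj using hsep
  have hlt : ∀ α β, α < β → U α ≠ U β := by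
    intro α β h heq
    obtain ⟨x, hxU, hx⟩ := hmeet β
    refine disjoint_left.1 (hdisj α) (heq ▸ hxU) (derivIter_antitone d B hd ?_ hx)
    exact Order.add_one_le_of_lt h
  have hinj : Function.Injective U := by
    intro α β heq
    rcases lt_trichotomy α β with h | h | h
    · exact absurd heq (hlt _ _ h)
    · exact h
    · exact absurd heq.symm (hlt _ _ h)
  have hcount : Countable (Set.Iio (Cardinal.aleph 1).ord) := hinj.countable
  rw [← Cardinal.mk_le_aleph0_iff, Cardinal.mk_Iio_ordinal, Cardinal.card_ord] at hcount
  simp at hcount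

end derivIter

theorem IsOpen.of_weakTop {V : Set X} (hV : IsOpen[weakTop X] V) : IsOpen V := by
  obtain ⟨U, hU, rfl⟩ := isOpen_induced_iff.1 hV
  exact hU.preimage (continuous_pi fun f : X →L[ℝ] ℝ => f.continuous)

theorem isOpen_weakTop_preimage_smul {V : Set X} (hV : IsOpen[weakTop X] V) (c : ℝ) :
    IsOpen[weakTop X] ((c • ·) ⁻¹' V) := by
  obtain ⟨U, hU, rfl⟩ := isOpen_induced_iff.1 hV
  refine isOpen_induced_iff.2 ⟨_, hU.preimage (continuous_const_smul c), ?_⟩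
  ext x
  simp only [mem_preimage]
  congr! 1
  ext f
  simp

theorem weakDeriv_subset (ε : ℝ) (C : Set X) : weakDeriv ε C ⊆ C :=
  sdiff_subset

theorem IsClosed.weakDeriv {C : Set X} (hC : IsClosed C) (ε : ℝ) : IsClosed (weakDeriv ε C) :=
  hC.sdiff (isOpen_iUnion fun _ => isOpen_iUnion fun hV => isOpen_iUnion fun _ => hV.of_weakTop)

/-- If no nonempty relatively weakly open subset of `D` has diameter less than `ε`, then the
derivation of any bounded set containing `D` still contains `D`. -/
theorem subset_weakDeriv {ε : ℝ} {C D : Set X} (hC : Bornology.IsBounded C) (hDC : D ⊆ C)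
    (hD : ∀ V, IsOpen[weakTop X] V → (V ∩ D).Nonempty → ε ≤ Metric.diam (V ∩ D)) :
    D ⊆ weakDeriv ε C := by
  refine fun x hx => ⟨hDC hx, fun hxV => ?_⟩
  simp only [mem_iUnion] at hxV
  obtain ⟨V, hV, hdiam, hxV⟩ := hxV
  have hle : Metric.diam (V ∩ D) ≤ Metric.diam (V ∩ C) :=
    Metric.diam_mono (inter_subset_inter_right V hDC) (hC.subset inter_subset_right)
  linarith [hD V hV ⟨x, hxV, hx⟩]

theorem weakDeriv_ne_self {C : Set X} {ε : ℝ}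
    (h : ∃ V : Set X, IsOpen[weakTop X] V ∧ (V ∩ C).Nonempty ∧ Metric.diam (V ∩ C) < ε) :
    weakDeriv ε C ≠ C := by
  obtain ⟨V, hV, ⟨x, hxV, hxC⟩, hdiam⟩ := h
  intro heq
  rw [← heq] at hxC
  refine hxC.2 ?_
  simp only [mem_iUnion]
  exact ⟨V, hV, hdiam, hxV⟩

/-- If some iterate of the weak derivation of the unit ball is empty, then every nonempty subset
of the unit ball has a nonempty relatively weakly open subset of small diameter. -/
theorem exists_diam_lt_of_subset_closedBall {ε : ℝ} {α : Ordinal} {D : Set X} (hne : D.Nonempty)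
    (hD : D ⊆ closedBall 0 1) (hα : derivIter (weakDeriv ε) (closedBall (0 : X) 1) α = ∅) :
    ∃ V : Set X, IsOpen[weakTop X] V ∧ (V ∩ D).Nonempty ∧ Metric.diam (V ∩ D) < ε := by
  by_contra! hdiam
  have hsub : D ⊆ derivIter (weakDeriv ε) (closedBall (0 : X) 1) α :=
    derivIter_induction (weakDeriv ε) _ (p := fun C => D ⊆ C) hD
      (fun C hC hDC => subset_weakDeriv (isBounded_closedBall.subset hC) hDC hdiam)
      (weakDeriv_subset ε) (fun _ h => subset_sInter h) α
  rw [hα] at hsub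
  exact hne.not_subset_empty hsub

/-- For a separable Banach space `X`: `X` has the Point of Continuity Property
iff `Φ(X) < ω₁`, i.e. for every `ε > 0` there is a countable ordinal `α` with
`σ_ε^α(B_X) = ∅`. -/
theorem statement2 {X : Type*} [NormedAddCommGroup X] [NormedSpace ℝ X] [CompleteSpace X]
    [TopologicalSpace.SeparableSpace X] :
    (∀ C : Set X, C.Nonempty → Bornology.IsBounded C → IsClosed C → ∀ ε > (0 : ℝ),
        ∃ V : Set X, IsOpen[weakTop X] V ∧ (V ∩ C).Nonempty ∧ Metric.diam (V ∩ C) < ε) ↔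
      (∀ ε > (0 : ℝ), ∃ α < (Cardinal.aleph 1).ord,
        derivIter (weakDeriv ε) (Metric.closedBall (0 : X) 1) α = ∅) := by
  constructor
  · intro hPCP ε hε
    have : SecondCountableTopology X := UniformSpace.secondCountable_of_separable X
    have hclosed : ∀ α, IsClosed (derivIter (weakDeriv ε) (closedBall (0 : X) 1) α) :=
      derivIter_induction _ _ isClosed_closedBall (fun C _ hC => hC.weakDeriv ε)
        (weakDeriv_subset ε) fun _ h => isClosed_sInter h
    obtain ⟨α, hα, heq⟩ := exists_derivIter_add_one_eq _ _ (weakDeriv_subset ε) hclosed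
    refine ⟨α, hα, not_nonempty_iff_eq_empty.1 fun hne => ?_⟩
    have hsub : derivIter (weakDeriv ε) (closedBall (0 : X) 1) α ⊆ closedBall 0 1 := by
      simpa only [derivIter_zero] using
        derivIter_antitone _ (closedBall (0 : X) 1) (weakDeriv_subset ε) (zero_le (a := α))
    rw [derivIter_add_one] at heq
    exact weakDeriv_ne_self (hPCP _ hne (isBounded_closedBall.subset hsub) (hclosed α) ε hε) heq
  · intro hΦ C hne hbdd _ ε hε
    obtain ⟨r, hr, hCr⟩ := hbdd.subset_closedBall_lt 0 (0 : X)
    obtain ⟨α, -, hα⟩ := hΦ (ε / r) (by positivity)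
    have hball : (r⁻¹ • ·) '' C ⊆ closedBall (0 : X) 1 := by
      rintro _ ⟨x, hx, rfl⟩
      have hxr := mem_closedBall_zero_iff.1 (hCr hx)
      rw [mem_closedBall_zero_iff, norm_smul, Real.norm_of_nonneg (inv_nonneg.2 hr.le),
        inv_mul_le_iff₀ hr]
      linarith
    obtain ⟨V, hV, ⟨_, hxV, x, hx, rfl⟩, hdiam⟩ :=
      exists_diam_lt_of_subset_closedBall (hne.image _) hball hα
    refine ⟨_, isOpen_weakTop_preimage_smul hV r⁻¹, ⟨x, hxV, hx⟩, ?_⟩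
    rw [lt_div_iff₀' hr] at hdiam
    refine lt_of_le_of_lt (Metric.diam_le_of_forall_dist_le (by positivity) ?_) hdiam
    intro y hy z hz
    have hyz : dist (r⁻¹ • y) (r⁻¹ • z) ≤ Metric.diam (V ∩ (r⁻¹ • ·) '' C) :=
      Metric.dist_le_diam_of_mem (isBounded_closedBall.subset (inter_subset_right.trans hball))
        ⟨hy.1, y, hy.2, rfl⟩ ⟨hz.1, z, hz.2, rfl⟩
    rwa [dist_smul₀, Real.norm_of_nonneg (inv_nonneg.2 hr.le), inv_mul_le_iff₀ hr] at hyz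
end
end

section
/- Let X and Y be Banach spaces and α ∈ (0, ω₁). Assume that Y bi-Lipschitz embeds into X. If Y has the α-tree property, then X has the α-tree property; equivalently, if X fails the α-tree property then so does Y. -/
open Metric Set Topology

noncomputable section

variable {X : Type*} [NormedAddCommGroup X] [NormedSpace ℝ X]

/-- `f : Y → X` is a bi-Lipschitz embedding. -/
def IsBiLipEmb {Y X : Type*} [NormedAddCommGroup Y] [NormedAddCommGroup X] (f : Y → X) : Prop :=
  ∃ A B : ℝ, 0 < A ∧ A ≤ B ∧
    ∀ u v : Y, A * ‖u - v‖ ≤ ‖f u - f v‖ ∧ ‖f u - f v‖ ≤ B * ‖u - v‖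

section TreeRoot

variable {Z : Type*} [NormedAddCommGroup Z] [NormedSpace ℝ Z] {C : Set Z} {δ : ℝ}

theorem treeRoot_zero (x : Z) : treeRoot C δ 0 x ↔ x ∈ C := by
  simp only [treeRoot, Ordinal.limitRecOn_zero]

theorem treeRoot_add_one (α : Ordinal) (x : Z) :
    treeRoot C δ (α + 1) x ↔ x ∈ C ∧ ∃ y z : Z,
      x = (2⁻¹ : ℝ) • (y + z) ∧ δ ≤ 2⁻¹ * ‖y - z‖ ∧ treeRoot C δ α y ∧ treeRoot C δ α z := by
  simp only [treeRoot, Ordinal.limitRecOn_add_one]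

theorem treeRoot_limit {α : Ordinal} (hα : Order.IsSuccLimit α) (x : Z) :
    treeRoot C δ α x ↔ ∀ γ < α, treeRoot C δ γ x := by
  simp only [treeRoot, Ordinal.limitRecOn_limit _ _ _ _ hα]

end TreeRoot

/-- Of two points `p`, `q` at distance at least `r`, one is at distance at least `r / 2` from the
midpoint of `a` and `b`. -/
theorem le_norm_second_difference {E : Type*} [NormedAddCommGroup E] [NormedSpace ℝ E]
    {a b p q : E} {r : ℝ} (h : r ≤ ‖p - q‖) :
    r ≤ ‖(p - a) - (b - p)‖ ∨ r ≤ ‖(q - a) - (b - q)‖ := by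
  by_contra! hlt
  have heq : (2 : ℝ) • (p - q) = ((p - a) - (b - p)) - ((q - a) - (b - q)) := by module
  have hle := norm_sub_le ((p - a) - (b - p)) ((q - a) - (b - q))
  rw [← heq, norm_smul, Real.norm_two] at hle
  linarith [hlt.1, hlt.2]

/-- A bi-Lipschitz map sends tree roots to tree roots through its difference quotients: a segment
in direction `x = (y + z) / 2` is broken into a half step along `y` and one along `z`, in the order
that moves the image of the break point away from the midpoint. -/
theorem treeRoot_differenceQuotient {E F : Type*} [NormedAddCommGroup E] [NormedSpace ℝ E]
    [NormedAddCommGroup F] [NormedSpace ℝ F] {f : F → E} {A B δ : ℝ} (hA : 0 < A) (hB : 0 < B)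
    (hf : ∀ u v : F, A * ‖u - v‖ ≤ ‖f u - f v‖ ∧ ‖f u - f v‖ ≤ B * ‖u - v‖)
    {α : Ordinal} {x : F} (hx : treeRoot (closedBall (0 : F) 1) δ α x)
    (u : F) {t : ℝ} (ht : 0 < t) :
    treeRoot (closedBall (0 : E) 1) (A * δ / B) α ((B * t)⁻¹ • (f (u + t • x) - f u)) := by
  have hball {x : F} (hx : x ∈ closedBall (0 : F) 1) (u : F) {t : ℝ} (ht : 0 < t) :
      (B * t)⁻¹ • (f (u + t • x) - f u) ∈ closedBall (0 : E) 1 := by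
    rw [mem_closedBall_zero_iff] at hx ⊢
    have hle := (hf (u + t • x) u).2
    rw [add_sub_cancel_left, norm_smul, Real.norm_of_nonneg ht.le] at hle
    rw [norm_smul, Real.norm_of_nonneg (by positivity), inv_mul_le_one₀ (by positivity)]
    calc _ ≤ B * (t * ‖x‖) := hle
      _ ≤ B * (t * 1) := by gcongr
      _ = B * t := by ring
  induction α using Ordinal.limitRecOn generalizing x u t with
  | zero => exact (treeRoot_zero _).2 (hball ((treeRoot_zero x).1 hx) u ht)
  | limit α hα ih =>
    exact (treeRoot_limit hα _).2 fun γ hγ =>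
      ih γ hγ ((treeRoot_limit hα x).1 hx γ hγ) u ht
  | add_one α ih =>
    obtain ⟨hxC, y, z, rfl, hδ, hy, hz⟩ := (treeRoot_add_one α x).1 hx
    refine (treeRoot_add_one α _).2 ⟨hball hxC u ht, ?_⟩
    have split {y z : F} (hy : treeRoot (closedBall (0 : F) 1) δ α y)
        (hz : treeRoot (closedBall (0 : F) 1) δ α z) {p b : E} (hp : f (u + (t / 2) • y) = p)
        (hb : f (u + t • (2⁻¹ : ℝ) • (y + z)) = b)
        (hsep : A * (t * δ) ≤ ‖(p - f u) - (b - p)‖) :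
        ∃ v w : E, (B * t)⁻¹ • (b - f u) = (2⁻¹ : ℝ) • (v + w) ∧ A * δ / B ≤ 2⁻¹ * ‖v - w‖ ∧
          treeRoot (closedBall (0 : E) 1) (A * δ / B) α v ∧
          treeRoot (closedBall (0 : E) 1) (A * δ / B) α w := by
      have hv := ih hy u (half_pos ht)
      have hw := ih hz (u + (t / 2) • y) (half_pos ht)
      rw [show u + (t / 2) • y + (t / 2) • z = u + t • (2⁻¹ : ℝ) • (y + z) by module, hb, hp] at hw
      rw [hp] at hv
      have hinv : (B * (t / 2))⁻¹ = 2 * (B * t)⁻¹ := by field_simp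
      refine ⟨_, _, ?_, ?_, hv, hw⟩
      · rw [hinv]
        module
      · rw [← smul_sub, norm_smul, Real.norm_of_nonneg (by positivity), hinv]
        calc A * δ / B = (B * t)⁻¹ * (A * (t * δ)) := by field_simp
          _ ≤ (B * t)⁻¹ * ‖(p - f u) - (b - p)‖ := by gcongr
          _ = _ := by ring
    have hdist : A * (t * δ) ≤ ‖f (u + (t / 2) • y) - f (u + (t / 2) • z)‖ := by
      refine le_trans ?_ (hf _ _).1
      rw [add_sub_add_left_eq_sub, ← smul_sub, norm_smul, Real.norm_of_nonneg (half_pos ht).le]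
      calc A * (t * δ) ≤ A * (t * (2⁻¹ * ‖y - z‖)) := by gcongr
        _ = _ := by ring
    rcases le_norm_second_difference (a := f u) (b := f (u + t • (2⁻¹ : ℝ) • (y + z))) hdist with
      h | h
    · exact split hy hz rfl rfl h
    · exact split hz hy rfl (by rw [add_comm z y]) h

/-- If `Y` bi-Lipschitz embeds into `X` and `Y` has the `α`-tree property
(`0 < α < ω₁`), then `X` has the `α`-tree property. -/
theorem statement14 {X Y : Type*} [NormedAddCommGroup X] [NormedSpace ℝ X] [CompleteSpace X]
    [NormedAddCommGroup Y] [NormedSpace ℝ Y] [CompleteSpace Y]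
    (α : Ordinal) (h0 : 0 < α) (hα : α < (Cardinal.aleph 1).ord)
    (hemb : ∃ f : Y → X, IsBiLipEmb f)
    (hY : ∃ δ > (0 : ℝ), ∃ y : Y, treeRoot (Metric.closedBall (0 : Y) 1) δ α y) :
    ∃ δ > (0 : ℝ), ∃ x : X, treeRoot (Metric.closedBall (0 : X) 1) δ α x := by
  obtain ⟨f, A, B, hA, hAB, hf⟩ := hemb
  obtain ⟨δ, hδ, y, hy⟩ := hY
  have hB : 0 < B := hA.trans_le hAB
  exact ⟨A * δ / B, by positivity, _, treeRoot_differenceQuotient hA hB hf hy 0 one_pos⟩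
end
end

section
/- Let X and Y be Banach spaces and α ∈ (0, ω₁). Assume that Y bi-Lipschitz embeds into X. If Y has the α-sprawling tree property, then X has the α-sprawling tree property; equivalently, if X fails the α-sprawling tree property then so does Y. -/
open Metric Set Topology

noncomputable section

variable {X : Type*} [NormedAddCommGroup X] [NormedSpace ℝ X]

theorem sprawlRoot_zero (C : Set X) (δ : ℝ) (x : X) : sprawlRoot C δ 0 x ↔ x ∈ C := by
  simp [sprawlRoot]

theorem sprawlRoot_add_one (C : Set X) (δ : ℝ) (α : Ordinal) (x : X) :
    sprawlRoot C δ (α + 1) x ↔ x ∈ C ∧ ∃ y z : ℕ → X,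
      (∀ n, x = (2⁻¹ : ℝ) • (y n + z n)) ∧
      (∀ n m, n ≠ m → δ ≤ ‖y n - y m‖) ∧
      (∀ n, sprawlRoot C δ α (y n)) ∧ (∀ n, sprawlRoot C δ α (z n)) := by
  simp only [sprawlRoot, Ordinal.limitRecOn_add_one]

theorem sprawlRoot_limit (C : Set X) (δ : ℝ) {o : Ordinal} (ho : Order.IsSuccLimit o) (x : X) :
    sprawlRoot C δ o x ↔ ∀ γ < o, sprawlRoot C δ γ x := by
  simp only [sprawlRoot, Ordinal.limitRecOn_limit _ _ _ _ ho]

/-- The difference quotients of a `1`-Lipschitz map with lower Lipschitz constant `c` carry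
`δ`-`α`-sprawling trees in the unit ball to `(c * δ)`-`α`-sprawling trees in the unit ball. -/
theorem sprawlRoot_differenceQuotient {Y : Type*} [NormedAddCommGroup Y] [NormedSpace ℝ Y]
    {f : Y → X} {c δ : ℝ} (hc : 0 ≤ c) (hlow : ∀ u v, c * ‖u - v‖ ≤ ‖f u - f v‖)
    (hup : ∀ u v, ‖f u - f v‖ ≤ ‖u - v‖) (α : Ordinal) :
    ∀ (y p : Y) (t : ℝ), 0 < t → sprawlRoot (closedBall (0 : Y) 1) δ α y →
      sprawlRoot (closedBall (0 : X) 1) (c * δ) α (t⁻¹ • (f (p + t • y) - f p)) := by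
  have hball : ∀ (y p : Y) (t : ℝ), 0 < t → y ∈ closedBall (0 : Y) 1 →
      t⁻¹ • (f (p + t • y) - f p) ∈ closedBall (0 : X) 1 := by
    intro y p t ht hy
    rw [mem_closedBall_zero_iff] at hy ⊢
    have h := hup (p + t • y) p
    rw [add_sub_cancel_left, norm_smul, Real.norm_of_nonneg ht.le] at h
    rw [norm_smul, norm_inv, Real.norm_of_nonneg ht.le, inv_mul_le_iff₀ ht]
    exact h.trans (mul_le_mul_of_nonneg_left hy ht.le)
  induction α using Ordinal.limitRecOn with
  | zero =>
    intro y p t ht hy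
    rw [sprawlRoot_zero] at hy ⊢
    exact hball y p t ht hy
  | add_one α ih =>
    intro x p t ht hx
    rw [sprawlRoot_add_one] at hx ⊢
    obtain ⟨hxC, y, z, hmid, hsep, hy, hz⟩ := hx
    have ht2 : 0 < t / 2 := half_pos ht
    refine ⟨hball x p t ht hxC,
      fun n => (t / 2)⁻¹ • (f (p + (t / 2) • y n) - f p),
      fun n => (t / 2)⁻¹ • (f (p + (t / 2) • y n + (t / 2) • z n) - f (p + (t / 2) • y n)),
      fun n => ?_, fun n m hnm => ?_, fun n => ih _ _ _ ht2 (hy n), fun n => ih _ _ _ ht2 (hz n)⟩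
    · have hp : p + (t / 2) • y n + (t / 2) • z n = p + t • x := by
        rw [hmid n]
        module
      beta_reduce
      rw [hp, ← smul_add, smul_smul, sub_add_sub_cancel']
      congr 1
      field_simp
    · have h := hlow (p + (t / 2) • y n) (p + (t / 2) • y m)
      rw [add_sub_add_left_eq_sub, ← smul_sub, norm_smul, Real.norm_of_nonneg ht2.le] at h
      rw [← smul_sub, sub_sub_sub_cancel_right, norm_smul, norm_inv, Real.norm_of_nonneg ht2.le,
        le_inv_mul_iff₀ ht2]
      calc t / 2 * (c * δ) ≤ t / 2 * (c * ‖y n - y m‖) := by gcongr; exact hsep n m hnm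
        _ = c * (t / 2 * ‖y n - y m‖) := by ring
        _ ≤ _ := h
  | limit o ho ih =>
    intro y p t ht hy
    rw [sprawlRoot_limit _ _ ho] at hy ⊢
    exact fun γ hγ => ih γ hγ y p t ht (hy γ hγ)

/-- If `Y` bi-Lipschitz embeds into `X` and `Y` has the `α`-sprawling tree
property (`0 < α < ω₁`), then `X` has the `α`-sprawling tree property. -/
theorem statement16 {X Y : Type*} [NormedAddCommGroup X] [NormedSpace ℝ X] [CompleteSpace X]
    [NormedAddCommGroup Y] [NormedSpace ℝ Y] [CompleteSpace Y]
    (α : Ordinal) (h0 : 0 < α) (hα : α < (Cardinal.aleph 1).ord)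
    (hemb : ∃ f : Y → X, IsBiLipEmb f)
    (hY : ∃ δ > (0 : ℝ), ∃ y : Y, sprawlRoot (Metric.closedBall (0 : Y) 1) δ α y) :
    ∃ δ > (0 : ℝ), ∃ x : X, sprawlRoot (Metric.closedBall (0 : X) 1) δ α x := by
  obtain ⟨f, A, B, hA, hAB, hf⟩ := hemb
  obtain ⟨δ, hδ, y, hy⟩ := hY
  have hB : 0 < B := hA.trans_le hAB
  have hnorm : ∀ u v, ‖B⁻¹ • f u - B⁻¹ • f v‖ = B⁻¹ * ‖f u - f v‖ := fun u v => by
    rw [← smul_sub, norm_smul, norm_inv, Real.norm_of_nonneg hB.le]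
  refine ⟨B⁻¹ * A * δ, by positivity, _,
    sprawlRoot_differenceQuotient (f := fun u => B⁻¹ • f u) (by positivity)
      (fun u v => ?_) (fun u v => ?_) α y 0 1 one_pos hy⟩
  · rw [hnorm, mul_assoc]
    exact mul_le_mul_of_nonneg_left (hf u v).1 (inv_nonneg.2 hB.le)
  · rw [hnorm, inv_mul_le_iff₀ hB]
    exact (hf u v).2
end
end
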